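/- arXiv:1904.04714 — 4 statements merged into one kernel-verified Lean document; each statement's English description precedes it below -/
import Mathlib

section
/- Let A be a real 3×3 matrix and ν ∈ ℝ³ a unit vector with A ν = 0. Then the Frobenius norm of the cofactor matrix equals the Euclidean norm of its action on ν: ‖cof(A)‖_F = ‖cof(A) ν‖₂. -/
open Matrix

/-- The cofactor matrix of a real 3×3 matrix: the transpose of the adjugate. -/
noncomputable def cof (A : Matrix (Fin 3) (Fin 3) ℝ) : Matrix (Fin 3) (Fin 3) ℝ :=
  A.adjugateᵀ

/-- The Euclidean norm on `ℝ³`. -/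
noncomputable def enorm3 (v : Fin 3 → ℝ) : ℝ := Real.sqrt (v ⬝ᵥ v)

/-- The Frobenius norm of a real 3×3 matrix. -/
noncomputable def frobNorm (M : Matrix (Fin 3) (Fin 3) ℝ) : ℝ :=
  Real.sqrt (∑ i, ∑ j, (M i j) ^ 2)

/-- Each row of the cofactor matrix is the cross product of the two cyclically following rows. -/
lemma cof_apply_eq_crossProduct (A : Matrix (Fin 3) (Fin 3) ℝ) (i : Fin 3) :
    cof A i = crossProduct (A (i + 1)) (A (i + 2)) := by
  ext j
  fin_cases i <;> fin_cases j <;>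
    simp [cof, adjugate_fin_three, cross_apply] <;> ring

/-- Cross products of vectors orthogonal to a unit vector are multiples of that vector, so
their squared length is the square of their component along it. -/
lemma crossProduct_dot_self_eq_sq (a b ν : Fin 3 → ℝ) (hν : ν ⬝ᵥ ν = 1)
    (ha : a ⬝ᵥ ν = 0) (hb : b ⬝ᵥ ν = 0) :
    crossProduct a b ⬝ᵥ crossProduct a b = (crossProduct a b ⬝ᵥ ν) ^ 2 := by
  have hc : crossProduct (crossProduct a b) ν = 0 := by
    simp [cross_cross_eq_smul_sub_smul, ha, hb]
  have h := cross_dot_cross (crossProduct a b) ν (crossProduct a b) ν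
  rw [hc, zero_dotProduct, hν, dotProduct_comm ν] at h
  linear_combination -h

/-- If `A` is a real 3×3 matrix and `ν` a unit vector with `A ν = 0`, then the
Frobenius norm of the cofactor matrix equals the Euclidean norm of its action on `ν`:
`‖cof(A)‖_F = ‖cof(A) ν‖₂`. -/
theorem frobNorm_cof_eq (A : Matrix (Fin 3) (Fin 3) ℝ) (ν : Fin 3 → ℝ)
    (hν : enorm3 ν = 1) (hA : A *ᵥ ν = 0) :
    frobNorm (cof A) = enorm3 (cof A *ᵥ ν) := by
  have hrow (i : Fin 3) : A i ⬝ᵥ ν = 0 := congrFun hA i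
  have h1 : ν ⬝ᵥ ν = 1 := Real.sqrt_eq_one.mp hν
  unfold frobNorm enorm3
  congr 1
  refine Finset.sum_congr rfl fun i _ => ?_
  have h := crossProduct_dot_self_eq_sq _ _ ν h1 (hrow (i + 1)) (hrow (i + 2))
  rw [← cof_apply_eq_crossProduct] at h
  simpa only [dotProduct, mulVec, ← sq] using h
end

section
/- For a real 3×3 matrix A and indices i, j ∈ {1,2,3}, define A#_{ij} ∈ M₃(ℝ) by: (A#_{ij})_{kl} = 0 if k = i or l = j, and otherwise (A#_{ij})_{kl} = (−1)^{i+j} (cof(Ā_{ij}))_{k',l'}, where Ā_{ij} is the 2×2 submatrix of A obtained by deleting row i and column j, cof denotes the 2×2 cofactor matrix, and (k',l') are the positions of (k,l) within the submatrix. Then for every differentiable matrix-valued function A : ℝ → M₃(ℝ) and every t, the cofactor matrix t ↦ cof(A(t)) is differentiable with (d/dt cof(A(t)))_{ij} = A(t)#_{ij} : A'(t), where M : N := ∑_{k,l} M_{kl} N_{kl} is the Frobenius inner product. -/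
open Matrix

attribute [local instance] Matrix.normedAddCommGroup Matrix.normedSpace

/-- The cofactor matrix of a square real matrix: the transpose of the adjugate. -/
noncomputable def cofactor {n : ℕ} (A : Matrix (Fin n) (Fin n) ℝ) :
    Matrix (Fin n) (Fin n) ℝ := A.adjugateᵀ

/-- Index of `k` inside the 2-element index set obtained from `Fin 3` by deleting `i`
(meaningful when `k ≠ i`). -/
def delIdx (i k : Fin 3) : Fin 2 :=
  if h : (k : ℕ) < (i : ℕ) then ⟨(k : ℕ), by omega⟩
  else ⟨(k : ℕ) - 1, by have := k.2; omega⟩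

/-- The 2×2 submatrix of `A` obtained by deleting row `i` and column `j`. -/
def delSubmatrix (A : Matrix (Fin 3) (Fin 3) ℝ) (i j : Fin 3) :
    Matrix (Fin 2) (Fin 2) ℝ := A.submatrix i.succAbove j.succAbove

/-- `A#_{ij}`: the matrix vanishing on row `i` and column `j`, whose remaining entries are
the signed cofactors of the 2×2 submatrix of `A` with row `i` and column `j` deleted. -/
noncomputable def sharp (A : Matrix (Fin 3) (Fin 3) ℝ) (i j : Fin 3) :
    Matrix (Fin 3) (Fin 3) ℝ :=
  Matrix.of fun k l =>
    if k = i ∨ l = j then 0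
    else (-1 : ℝ) ^ ((i : ℕ) + (j : ℕ)) *
      cofactor (delSubmatrix A i j) (delIdx i k) (delIdx j l)

/-- The Frobenius inner product `M : N = ∑ₖₗ Mₖₗ Nₖₗ` of 3×3 matrices. -/
def frobInner (M N : Matrix (Fin 3) (Fin 3) ℝ) : ℝ := ∑ k, ∑ l, M k l * N k l

/-- Expansion of a cofactor of a 3×3 matrix along the complementary 2×2 minor. -/
theorem cofactor_apply_eq_minor (A : Matrix (Fin 3) (Fin 3) ℝ) (i j : Fin 3) :
    cofactor A i j = (-1 : ℝ) ^ ((i : ℕ) + (j : ℕ)) *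
      (A (i.succAbove 0) (j.succAbove 0) * A (i.succAbove 1) (j.succAbove 1) -
        A (i.succAbove 0) (j.succAbove 1) * A (i.succAbove 1) (j.succAbove 0)) := by
  rw [cofactor, transpose_apply, adjugate_fin_succ_eq_det_submatrix, det_fin_two]
  simp only [submatrix_apply]

/-- The pairing of `A#_{ij}` with `N` is the signed polarized minor of `A` and `N`. -/
theorem frobInner_sharp (A N : Matrix (Fin 3) (Fin 3) ℝ) (i j : Fin 3) :
    frobInner (sharp A i j) N = (-1 : ℝ) ^ ((i : ℕ) + (j : ℕ)) *
      ((N (i.succAbove 0) (j.succAbove 0) * A (i.succAbove 1) (j.succAbove 1) +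
        A (i.succAbove 0) (j.succAbove 0) * N (i.succAbove 1) (j.succAbove 1)) -
      (N (i.succAbove 0) (j.succAbove 1) * A (i.succAbove 1) (j.succAbove 0) +
        A (i.succAbove 0) (j.succAbove 1) * N (i.succAbove 1) (j.succAbove 0))) := by
  have h : ∀ i : Fin 3, ∀ k : Fin 2, delIdx i (i.succAbove k) = k := by decide
  rw [frobInner, Fin.sum_univ_succAbove _ i, Fin.sum_univ_two]
  simp only [fun f : Fin 3 → ℝ => Fin.sum_univ_succAbove f j, Fin.sum_univ_two, sharp, of_apply,
    h, Fin.succAbove_ne, true_or, or_true, or_self, if_true, if_false, zero_mul, zero_add,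
    cofactor, transpose_apply, adjugate_fin_two, delSubmatrix, submatrix_apply, cons_val_zero,
    cons_val_one, cons_val', cons_val_fin_one]
  ring

/-- For every differentiable matrix-valued function `A : ℝ → M₃(ℝ)` and every `t`, the
cofactor matrix `t ↦ cof(A(t))` is differentiable with
`(d/dt cof(A(t)))_{ij} = A(t)#_{ij} : A'(t)`. -/
theorem hasDerivAt_cofactor (A A' : ℝ → Matrix (Fin 3) (Fin 3) ℝ)
    (hA : ∀ s, HasDerivAt A (A' s) s) (t : ℝ) :
    HasDerivAt (fun s => cofactor (A s))
      (Matrix.of fun i j => frobInner (sharp (A t) i j) (A' t)) t := by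
  have hent : ∀ k l, HasDerivAt (fun s => A s k l) (A' t k l) t := fun k l =>
    hasDerivAt_pi.1 (hasDerivAt_pi.1 (hA t) k) l
  refine hasDerivAt_pi.2 fun i => hasDerivAt_pi.2 fun j => ?_
  simp only [cofactor_apply_eq_minor, of_apply, frobInner_sharp]
  exact (((hent _ _).mul (hent _ _)).sub ((hent _ _).mul (hent _ _))).const_mul _
end

section
/- Let H be a real inner product space, w ∈ H with ‖w‖ = 1, and let P : H → H be an orthogonal projection (P linear, P² = P, ⟨Px, y⟩ = ⟨x, Py⟩ for all x, y) with P w ≠ 0. Then ‖ Pw/‖Pw‖ − Pw ‖ ≤ ‖ w − Pw ‖². -/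
open scoped RealInnerProductSpace

/-- Let `H` be a real inner product space, `w ∈ H` with `‖w‖ = 1`, and `P : H → H` an
orthogonal projection (`P` linear, `P² = P`, self-adjoint) with `P w ≠ 0`. Then
`‖Pw/‖Pw‖ − Pw‖ ≤ ‖w − Pw‖²`. -/
theorem renormalization_error {H : Type*} [NormedAddCommGroup H]
    [InnerProductSpace ℝ H] (w : H) (hw : ‖w‖ = 1) (P : H →ₗ[ℝ] H)
    (hidem : ∀ x, P (P x) = P x)
    (hsym : ∀ x y, ⟪P x, y⟫ = ⟪x, P y⟫)
    (hPw : P w ≠ 0) :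
    ‖(‖P w‖⁻¹ • P w) - P w‖ ≤ ‖w - P w‖ ^ 2 := by
  have hinner : ⟪w, P w⟫ = ‖P w‖ ^ 2 := by
    rw [← real_inner_self_eq_norm_sq, hsym, hidem]
  have hpyth : ‖w - P w‖ ^ 2 = 1 - ‖P w‖ ^ 2 := by
    rw [norm_sub_sq_real, hinner, hw]
    ring
  have hpos : 0 < ‖P w‖ := norm_pos_iff.mpr hPw
  have hle : ‖P w‖ ≤ 1 := by nlinarith [sq_nonneg ‖w - P w‖]
  have hnorm : ‖(‖P w‖⁻¹ • P w) - P w‖ = 1 - ‖P w‖ := by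
    have hsmul : (‖P w‖⁻¹ • P w) - P w = (‖P w‖⁻¹ - 1) • P w := by
      rw [sub_smul, one_smul]
    rw [hsmul, norm_smul, Real.norm_of_nonneg (sub_nonneg.mpr ((one_le_inv₀ hpos).mpr hle)),
      sub_mul, inv_mul_cancel₀ hpos.ne', one_mul]
  rw [hnorm, hpyth]
  nlinarith
end

section
/- Let ν ∈ ℝ³ be a unit vector and P := I − ν ⊗ ν ∈ M₃(ℝ). For G ∈ M₃(ℝ) with G ν = 0 and cof(P + G) ν ≠ 0, define n(G) := cof(P + G) ν / ‖cof(P + G) ν‖. Then n(0) = ν, and as G → 0 (over matrices with Gν = 0), ‖ n(G) − ν + Gᵀ ν ‖ = O(‖G‖²); i.e., the deformed unit normal satisfies the linearization ν∘φ − ν = −(∇u)ᵀ ν + O(ε²). -/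
open Matrix

/-- The deformed unit normal `n(G) := cof(P + G) ν / ‖cof(P + G) ν‖` with
`P := I − ν ⊗ ν`. -/
noncomputable def nG (ν : Fin 3 → ℝ) (G : Matrix (Fin 3) (Fin 3) ℝ) : Fin 3 → ℝ :=
  (enorm3 (cof ((1 : Matrix (Fin 3) (Fin 3) ℝ) - vecMulVec ν ν + G) *ᵥ ν))⁻¹ •
    (cof ((1 : Matrix (Fin 3) (Fin 3) ℝ) - vecMulVec ν ν + G) *ᵥ ν)

theorem enorm3_eq_norm (v : Fin 3 → ℝ) : enorm3 v = ‖WithLp.toLp 2 v‖ := by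
  simp [enorm3, EuclideanSpace.norm_eq, dotProduct, sq]

theorem frobNorm_nonneg (M : Matrix (Fin 3) (Fin 3) ℝ) : 0 ≤ frobNorm M := Real.sqrt_nonneg _

theorem frobNorm_transpose (M : Matrix (Fin 3) (Fin 3) ℝ) : frobNorm Mᵀ = frobNorm M := by
  simp only [frobNorm, transpose_apply]
  rw [Finset.sum_comm]

theorem abs_apply_le_frobNorm (M : Matrix (Fin 3) (Fin 3) ℝ) (i j : Fin 3) :
    |M i j| ≤ frobNorm M := by
  refine Real.abs_le_sqrt ?_
  calc (M i j) ^ 2 ≤ ∑ j, (M i j) ^ 2 :=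
        Finset.single_le_sum (f := fun j => (M i j) ^ 2) (fun _ _ => sq_nonneg _)
          (Finset.mem_univ j)
    _ ≤ ∑ i, ∑ j, (M i j) ^ 2 :=
        Finset.single_le_sum (f := fun i => ∑ j, (M i j) ^ 2)
          (fun _ _ => Finset.sum_nonneg fun _ _ => sq_nonneg _) (Finset.mem_univ i)

theorem enorm3_mulVec_le (M : Matrix (Fin 3) (Fin 3) ℝ) (v : Fin 3 → ℝ) :
    enorm3 (M *ᵥ v) ≤ frobNorm M * enorm3 v := by
  rw [enorm3, enorm3, frobNorm, ← Real.sqrt_mul (by positivity)]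
  refine Real.sqrt_le_sqrt ?_
  rw [Finset.sum_mul]
  simp only [dotProduct, mulVec, ← sq]
  exact Finset.sum_le_sum fun i _ => Finset.sum_mul_sq_le_sq_mul_sq _ _ _

theorem frobNorm_cof_le (M : Matrix (Fin 3) (Fin 3) ℝ) :
    frobNorm (cof M) ≤ 6 * frobNorm M ^ 2 := by
  have minor (i j k l a b c d : Fin 3) :
      (M i j * M k l - M a b * M c d) ^ 2 ≤ (2 * frobNorm M ^ 2) ^ 2 := by
    refine sq_le_sq' ?_ ?_ <;>
    · have h₁ := mul_le_mul (abs_apply_le_frobNorm M i j) (abs_apply_le_frobNorm M k l)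
        (abs_nonneg _) (frobNorm_nonneg M)
      have h₂ := mul_le_mul (abs_apply_le_frobNorm M a b) (abs_apply_le_frobNorm M c d)
        (abs_nonneg _) (frobNorm_nonneg M)
      rw [← abs_mul] at h₁ h₂
      have := abs_le.mp h₁
      have := abs_le.mp h₂
      linarith
  have entry (i j : Fin 3) : (cof M i j) ^ 2 ≤ (2 * frobNorm M ^ 2) ^ 2 := by
    rw [cof, adjugate_fin_three]
    fin_cases i <;> fin_cases j <;> simp only [Fin.zero_eta, Fin.mk_one, Fin.reduceFinMk,
      transpose_apply, of_apply, cons_val, neg_add_eq_sub] <;> exact minor _ _ _ _ _ _ _ _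
  refine Real.sqrt_le_iff.mpr ⟨by positivity, ?_⟩
  calc ∑ i, ∑ j, (cof M i j) ^ 2 ≤ ∑ _i : Fin 3, ∑ _j : Fin 3, (2 * frobNorm M ^ 2) ^ 2 :=
        Finset.sum_le_sum fun i _ => Finset.sum_le_sum fun j _ => entry i j
    _ = (6 * frobNorm M ^ 2) ^ 2 := by simp; ring

theorem abs_trace_le_frobNorm (M : Matrix (Fin 3) (Fin 3) ℝ) : |M.trace| ≤ 3 * frobNorm M := by
  rw [trace]
  refine (Finset.abs_sum_le_sum_abs _ _).trans ?_
  refine (Finset.sum_le_sum fun i _ => abs_apply_le_frobNorm M i i).trans ?_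
  simp

/-- Exact expansion of the unnormalized deformed normal. -/
theorem cof_proj_add_mulVec (ν : Fin 3 → ℝ) (G : Matrix (Fin 3) (Fin 3) ℝ) :
    cof ((1 : Matrix (Fin 3) (Fin 3) ℝ) - vecMulVec ν ν + G) *ᵥ ν =
      (1 + G.trace) • ν - Gᵀ *ᵥ ν + cof G *ᵥ ν := by
  rw [cof, cof, adjugate_fin_three, adjugate_fin_three]
  ext i
  fin_cases i <;> simp [mulVec, dotProduct, Fin.sum_univ_three, trace, vecMulVec_apply, one_apply]
  all_goals ring

/-- Normalizing a vector of the form `(1 + t) ν - w + r`, with `w ⟂ ν` and `r` quadratically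
small, agrees with `ν - w` up to a quadratic error. -/
theorem norm_normalize_sub_add_le {V : Type*} [NormedAddCommGroup V] [InnerProductSpace ℝ V]
    {ν w r : V} {t f : ℝ} (hν : ‖ν‖ = 1) (hw : inner ℝ ν w = 0) (hf : f < 1 / 10)
    (ht : |t| ≤ 3 * f) (hwf : ‖w‖ ≤ f) (hr : ‖r‖ ≤ 6 * f ^ 2) :
    ‖‖(1 + t) • ν - w + r‖⁻¹ • ((1 + t) • ν - w + r) - ν + w‖ ≤ 40 * f ^ 2 := by
  set m := (1 + t) • ν - w + r with hm
  set q := ‖m‖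
  have hf0 : 0 ≤ f := (norm_nonneg w).trans hwf
  obtain ⟨ht₁, ht₂⟩ := abs_le.mp ht
  have hmain : ‖(1 + t) • ν - w‖ ^ 2 = (1 + t) ^ 2 + ‖w‖ ^ 2 := by
    rw [norm_sub_sq_real, inner_smul_left, hw, norm_smul, hν, mul_one, Real.norm_eq_abs, sq_abs]
    simp
  have hlow : 1 + t ≤ ‖(1 + t) • ν - w‖ :=
    pow_le_pow_iff_left₀ (by linarith) (norm_nonneg _) two_ne_zero |>.mp
      (by rw [hmain]; nlinarith [sq_nonneg ‖w‖])
  have hupp : ‖(1 + t) • ν - w‖ ≤ 1 + t + f ^ 2 := by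
    refine pow_le_pow_iff_left₀ (norm_nonneg _) (by nlinarith) two_ne_zero |>.mp ?_
    rw [hmain]
    have : ‖w‖ ^ 2 ≤ f ^ 2 := by gcongr
    nlinarith [mul_nonneg (sq_nonneg f) (by linarith : (0 : ℝ) ≤ 1 + 2 * t), sq_nonneg (f ^ 2)]
  have hq₁ : 1 + t - 6 * f ^ 2 ≤ q := by
    have := norm_sub_le_norm_add ((1 + t) • ν - w) r
    linarith
  have hq₂ : q ≤ 1 + t + 7 * f ^ 2 := by
    have := norm_add_le ((1 + t) • ν - w) r
    linarith
  have hf2 : f ^ 2 ≤ f / 10 := by nlinarith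
  have hqhalf : 1 / 2 ≤ q := by linarith
  have hqpos : 0 < q := by linarith
  have hdecomp : q⁻¹ • m - ν + w = q⁻¹ • ((1 + t - q) • ν + (q - 1) • w + r) := by
    have : q⁻¹ • q • (w - ν) = w - ν := inv_smul_smul₀ hqpos.ne' _
    rw [hm, show q⁻¹ • ((1 + t) • ν - w + r) - ν + w =
      q⁻¹ • ((1 + t) • ν - w + r) + (w - ν) by abel, ← this, ← smul_add]
    congr 1
    module
  have h₁ : ‖(1 + t - q) • ν‖ ≤ 7 * f ^ 2 := by
    rw [norm_smul, hν, mul_one, Real.norm_eq_abs, abs_le]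
    constructor <;> nlinarith
  have h₂ : ‖(q - 1) • w‖ ≤ 4 * f ^ 2 := by
    rw [norm_smul, Real.norm_eq_abs]
    have : |q - 1| ≤ 4 * f := abs_le.mpr ⟨by linarith, by linarith⟩
    calc |q - 1| * ‖w‖ ≤ 4 * f * f := by gcongr
      _ = 4 * f ^ 2 := by ring
  have hinv : q⁻¹ ≤ 2 := inv_le_of_inv_le₀ (by norm_num) (by linarith)
  rw [hdecomp, norm_smul, norm_inv, Real.norm_of_nonneg hqpos.le]
  calc q⁻¹ * ‖(1 + t - q) • ν + (q - 1) • w + r‖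
      ≤ 2 * (7 * f ^ 2 + 4 * f ^ 2 + 6 * f ^ 2) := by
        gcongr
        exact norm_add₃_le.trans (by gcongr)
    _ ≤ 40 * f ^ 2 := by nlinarith

/-- Let `ν ∈ ℝ³` be a unit vector, `P := I − ν ⊗ ν`, and for `G` with `G ν = 0` and
`cof(P + G) ν ≠ 0` let `n(G) := cof(P + G) ν / ‖cof(P + G) ν‖`. Then `n(0) = ν`, and as
`G → 0` over matrices with `G ν = 0`, `‖n(G) − ν + Gᵀ ν‖ = O(‖G‖²)`; i.e. the deformed
unit normal satisfies the linearization `ν∘φ − ν = −(∇u)ᵀ ν + O(ε²)`. -/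
theorem normal_linearization (ν : Fin 3 → ℝ) (hν : enorm3 ν = 1) :
    nG ν 0 = ν ∧
      ∃ C δ : ℝ, 0 < C ∧ 0 < δ ∧
        ∀ G : Matrix (Fin 3) (Fin 3) ℝ, G *ᵥ ν = 0 → frobNorm G < δ →
          cof ((1 : Matrix (Fin 3) (Fin 3) ℝ) - vecMulVec ν ν + G) *ᵥ ν ≠ 0 →
          enorm3 (nG ν G - ν + Gᵀ *ᵥ ν) ≤ C * frobNorm G ^ 2 := by
  refine ⟨?_, 40, 1 / 10, by norm_num, by norm_num, fun G hG hδ _ => ?_⟩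
  · have hcof : cof 0 = 0 := by
      rw [cof, adjugate_zero, transpose_zero]
    rw [nG, cof_proj_add_mulVec, hcof]
    simp [hν]
  · rw [nG, cof_proj_add_mulVec, enorm3_eq_norm, enorm3_eq_norm]
    have hw : enorm3 (Gᵀ *ᵥ ν) ≤ frobNorm G := by
      simpa [hν, frobNorm_transpose] using enorm3_mulVec_le Gᵀ ν
    have hr : enorm3 (cof G *ᵥ ν) ≤ 6 * frobNorm G ^ 2 := by
      have := enorm3_mulVec_le (cof G) ν
      rw [hν, mul_one] at this
      exact this.trans (frobNorm_cof_le G)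
    rw [enorm3_eq_norm] at hν hw hr
    have hperp : inner ℝ (WithLp.toLp 2 ν) (WithLp.toLp 2 (Gᵀ *ᵥ ν)) = 0 := by
      rw [EuclideanSpace.inner_toLp_toLp, star_trivial, mulVec_transpose, ← dotProduct_mulVec, hG,
        dotProduct_zero]
    simpa only [WithLp.toLp_add, WithLp.toLp_sub, WithLp.toLp_smul] using
      norm_normalize_sub_add_le hν hperp hδ (abs_trace_le_frobNorm G) hw hr
end
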